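/- Divergence of the Gogatishvili–Pick integral condition for the limiting Sobolev embedding: let d ≥ 1, α > 0, 1 < p < q < ∞, b > 1/q, and define u(t) = t^{dp−d−1} for 0 < t < 1 and u(t) = t^{αp+dp−d−1} for t ≥ 1; U(t) = ∫₀^t u; v(t) = t^{dq−dq/p−1} for 0 < t < 1 and v(t) = t^{αq+dq−dq/p−1}(1+log t)^{−bq} for t ≥ 1; V(t) = ∫₀^t v; w(t) = 0 for t < 1 and w(t) = t^{αr+dr−dr/p−1}(1+log t)^{(−b+1/q)r} for t ≥ 1 with p < r < q and α − d/p = −d/ρ for some ρ... Then the integral ∫₁^∞ [U(t)^P sup_{y≥t} U(y)^{−P}W(y)^{P/R}] / [V(t)+U(t)^Q∫_t^∞ U(s)^{−Q}v(s)ds]^{P/Q+2} · V(t)∫_t^∞ U(s)^{−Q}v(s) ds · d(U^Q(t)), with R = r/p, Q = q/p, P = QR/(Q−R), is comparable to ∫₁^∞ dt/((1+log t)·t) and hence diverges. -/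

import Mathlib

open MeasureTheory
open scoped ENNReal

/-- `u(t) = t^{dp−d−1}` for `t < 1`, `u(t) = t^{αp+dp−d−1}` for `t ≥ 1`. -/
noncomputable def uFun (d : ℕ) (α p : ℝ) (t : ℝ) : ℝ≥0∞ :=
  if t < 1 then ENNReal.ofReal (t ^ ((d:ℝ)*p - d - 1))
  else ENNReal.ofReal (t ^ (α*p + (d:ℝ)*p - d - 1))

/-- `v(t) = t^{dq−dq/p−1}` for `t < 1`,
`v(t) = t^{αq+dq−dq/p−1}(1+log t)^{−bq}` for `t ≥ 1`. -/
noncomputable def vFun (d : ℕ) (α p q b : ℝ) (t : ℝ) : ℝ≥0∞ :=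
  if t < 1 then ENNReal.ofReal (t ^ ((d:ℝ)*q - (d:ℝ)*q/p - 1))
  else ENNReal.ofReal (t ^ (α*q + (d:ℝ)*q - (d:ℝ)*q/p - 1) * (1 + Real.log t) ^ (-(b*q)))

/-- `w(t) = 0` for `t < 1`, `w(t) = t^{αr+dr−dr/p−1}(1+log t)^{(−b+1/q)r}` for `t ≥ 1`. -/
noncomputable def wFun (d : ℕ) (α p q b r : ℝ) (t : ℝ) : ℝ≥0∞ :=
  if t < 1 then 0
  else ENNReal.ofReal (t ^ (α*r + (d:ℝ)*r - (d:ℝ)*r/p - 1) * (1 + Real.log t) ^ ((-b + 1/q)*r))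

noncomputable def UFun (d : ℕ) (α p : ℝ) (t : ℝ) : ℝ≥0∞ :=
  ∫⁻ s in Set.Ioo (0:ℝ) t, uFun d α p s

noncomputable def VFun (d : ℕ) (α p q b : ℝ) (t : ℝ) : ℝ≥0∞ :=
  ∫⁻ s in Set.Ioo (0:ℝ) t, vFun d α p q b s

noncomputable def WFun (d : ℕ) (α p q b r : ℝ) (t : ℝ) : ℝ≥0∞ :=
  ∫⁻ s in Set.Ioo (0:ℝ) t, wFun d α p q b r s

noncomputable def gpMo (a β t : ℝ) : ℝ≥0∞ := ENNReal.ofReal (t ^ a * (1 + Real.log t) ^ β)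

lemma gp_L {t : ℝ} (ht : 1 ≤ t) : 1 ≤ 1 + Real.log t := by
  have := Real.log_nonneg ht; linarith

lemma gpMo_pos' {a β t : ℝ} (ht : 1 ≤ t) : 0 < t ^ a * (1 + Real.log t) ^ β := by
  have h1 := gp_L ht
  have : 0 < t := by linarith
  have : 0 < 1 + Real.log t := by linarith
  positivity

lemma gpMo_ne_zero {a β t : ℝ} (ht : 1 ≤ t) : gpMo a β t ≠ 0 := by
  have := gpMo_pos' (a := a) (β := β) ht
  simpa [gpMo] using this

lemma gpMo_ne_top {a β t : ℝ} : gpMo a β t ≠ ⊤ := by simp [gpMo]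

lemma gpMo_mul {a β a' β' t : ℝ} (ht : 1 ≤ t) :
    gpMo a β t * gpMo a' β' t = gpMo (a + a') (β + β') t := by
  have h1 := gp_L ht
  unfold gpMo
  rw [← ENNReal.ofReal_mul (gpMo_pos' ht).le, Real.rpow_add (by linarith), Real.rpow_add (by linarith)]
  congr 1; ring

lemma gpMo_rpow {a β t : ℝ} (ht : 1 ≤ t) (s : ℝ) :
    gpMo a β t ^ s = gpMo (a * s) (β * s) t := by
  have h1 := gp_L ht
  unfold gpMo
  rw [ENNReal.ofReal_rpow_of_pos (gpMo_pos' ht), Real.mul_rpow (by positivity) (by positivity),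
    ← Real.rpow_mul (by linarith), ← Real.rpow_mul (by linarith)]

lemma gpMo_inv {a β t : ℝ} (ht : 1 ≤ t) :
    (gpMo a β t)⁻¹ = gpMo (-a) (-β) t := by
  rw [← ENNReal.rpow_neg_one, gpMo_rpow ht]; simp

lemma gpMo_mono {a β β' t : ℝ} (ht : 1 ≤ t) (h : β ≤ β') : gpMo a β t ≤ gpMo a β' t := by
  have h1 := gp_L ht
  unfold gpMo
  gcongr

def gpLB (F : ℝ → ℝ≥0∞) (a β : ℝ) : Prop :=
  ∃ c : ℝ≥0∞, c ≠ 0 ∧ c ≠ ⊤ ∧ ∀ t, 1 ≤ t → c * gpMo a β t ≤ F t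

def gpUB (F : ℝ → ℝ≥0∞) (a β : ℝ) : Prop :=
  ∃ c : ℝ≥0∞, c ≠ 0 ∧ c ≠ ⊤ ∧ ∀ t, 1 ≤ t → F t ≤ c * gpMo a β t

lemma gpLB.mul {F G : ℝ → ℝ≥0∞} {a β a' β' : ℝ} (h : gpLB F a β) (h' : gpLB G a' β') :
    gpLB (fun t => F t * G t) (a + a') (β + β') := by
  obtain ⟨c, c0, c1, hc⟩ := h
  obtain ⟨e, e0, e1, he⟩ := h'
  refine ⟨c * e, mul_ne_zero c0 e0, ENNReal.mul_ne_top c1 e1, fun t ht => ?_⟩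
  rw [← gpMo_mul ht, mul_mul_mul_comm]
  exact mul_le_mul' (hc t ht) (he t ht)

lemma gpUB.mul {F G : ℝ → ℝ≥0∞} {a β a' β' : ℝ} (h : gpUB F a β) (h' : gpUB G a' β') :
    gpUB (fun t => F t * G t) (a + a') (β + β') := by
  obtain ⟨c, c0, c1, hc⟩ := h
  obtain ⟨e, e0, e1, he⟩ := h'
  refine ⟨c * e, mul_ne_zero c0 e0, ENNReal.mul_ne_top c1 e1, fun t ht => ?_⟩
  rw [← gpMo_mul ht, mul_mul_mul_comm]
  exact mul_le_mul' (hc t ht) (he t ht)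

lemma gpUB.add {F G : ℝ → ℝ≥0∞} {a β : ℝ} (h : gpUB F a β) (h' : gpUB G a β) :
    gpUB (fun t => F t + G t) a β := by
  obtain ⟨c, c0, c1, hc⟩ := h
  obtain ⟨e, e0, e1, he⟩ := h'
  refine ⟨c + e, by simp [c0], by simp [c1, e1], fun t ht => ?_⟩
  rw [add_mul]
  exact add_le_add (hc t ht) (he t ht)

lemma gpUB.mono {F : ℝ → ℝ≥0∞} {a β β' : ℝ} (h : gpUB F a β) (hb : β ≤ β') :
    gpUB F a β' := by
  obtain ⟨c, c0, c1, hc⟩ := h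
  exact ⟨c, c0, c1, fun t ht => (hc t ht).trans (mul_le_mul' le_rfl (gpMo_mono ht hb))⟩

lemma gpLB.rpow {F : ℝ → ℝ≥0∞} {a β : ℝ} (h : gpLB F a β) {s : ℝ} (hs : 0 ≤ s) :
    gpLB (fun t => F t ^ s) (a * s) (β * s) := by
  obtain ⟨c, c0, c1, hc⟩ := h
  refine ⟨c ^ s, by simp [c0, c1], by simp [c0, c1], fun t ht => ?_⟩
  rw [← gpMo_rpow ht, ← ENNReal.mul_rpow_of_nonneg _ _ hs]
  exact ENNReal.rpow_le_rpow (hc t ht) hs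

lemma gpUB.rpow {F : ℝ → ℝ≥0∞} {a β : ℝ} (h : gpUB F a β) {s : ℝ} (hs : 0 ≤ s) :
    gpUB (fun t => F t ^ s) (a * s) (β * s) := by
  obtain ⟨c, c0, c1, hc⟩ := h
  refine ⟨c ^ s, by simp [c0, c1], by simp [c0, c1], fun t ht => ?_⟩
  rw [← gpMo_rpow ht, ← ENNReal.mul_rpow_of_nonneg _ _ hs]
  exact ENNReal.rpow_le_rpow (hc t ht) hs

lemma gpUB.inv {F : ℝ → ℝ≥0∞} {a β : ℝ} (h : gpUB F a β) :
    gpLB (fun t => (F t)⁻¹) (-a) (-β) := by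
  obtain ⟨c, c0, c1, hc⟩ := h
  refine ⟨c⁻¹, by simp [c1], by simp [c0], fun t ht => ?_⟩
  rw [← gpMo_inv ht, ← ENNReal.mul_inv (Or.inl c0) (Or.inl c1)]
  exact ENNReal.inv_le_inv.2 (hc t ht)

lemma gpLB.inv {F : ℝ → ℝ≥0∞} {a β : ℝ} (h : gpLB F a β) :
    gpUB (fun t => (F t)⁻¹) (-a) (-β) := by
  obtain ⟨c, c0, c1, hc⟩ := h
  refine ⟨c⁻¹, by simp [c1], by simp [c0], fun t ht => ?_⟩
  rw [← gpMo_inv ht, ← ENNReal.mul_inv (Or.inl c0) (Or.inl c1)]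
  exact ENNReal.inv_le_inv.2 (hc t ht)

lemma gpUB.rpow_neg {F : ℝ → ℝ≥0∞} {a β : ℝ} (h : gpUB F a β) {s : ℝ} (hs : 0 ≤ s) :
    gpLB (fun t => F t ^ (-s)) (-(a * s)) (-(β * s)) := by
  simp only [ENNReal.rpow_neg]
  exact (h.rpow hs).inv

lemma gpLB.rpow_neg {F : ℝ → ℝ≥0∞} {a β : ℝ} (h : gpLB F a β) {s : ℝ} (hs : 0 ≤ s) :
    gpUB (fun t => F t ^ (-s)) (-(a * s)) (-(β * s)) := by
  simp only [ENNReal.rpow_neg]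
  exact (h.rpow hs).inv

lemma gp_int_rpow {B x t : ℝ} (hB : 0 < B) (hx : 0 ≤ x) (hxt : x ≤ t) :
    ∫⁻ s in Set.Ioo x t, ENNReal.ofReal (s ^ (B - 1)) = ENNReal.ofReal ((t ^ B - x ^ B) / B) := by
  have hi : IntegrableOn (fun s : ℝ => s ^ (B - 1)) (Set.Ioc x t) volume := by
    rw [← intervalIntegrable_iff_integrableOn_Ioc_of_le hxt]
    exact intervalIntegral.intervalIntegrable_rpow' (by linarith)
  rw [setLIntegral_congr Ioo_ae_eq_Ioc, ← ofReal_integral_eq_lintegral_ofReal hi,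
    ← intervalIntegral.integral_of_le hxt, integral_rpow (Or.inl (by linarith))]
  · simp
  · filter_upwards [ae_restrict_mem measurableSet_Ioc] with s hs
    exact Real.rpow_nonneg (hx.trans hs.1.le) _

lemma gp_tail {γ t : ℝ} (hγ : 1 < γ) (ht : 1 ≤ t) :
    ∫⁻ s in Set.Ioi t, gpMo (-1) (-γ) s = ENNReal.ofReal (γ - 1)⁻¹ * gpMo 0 (1 - γ) t := by
  have hg : ∀ x ∈ Set.Ici t, HasDerivAt (fun s => -((γ - 1)⁻¹ * (1 + Real.log s) ^ (1 - γ)))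
      (x ^ (-1:ℝ) * (1 + Real.log x) ^ (-γ)) x := by
    intro x hx
    have hx1 : 1 ≤ x := ht.trans hx
    have h1 := gp_L hx1
    have h := (((Real.hasDerivAt_log (by linarith : x ≠ 0)).const_add 1).rpow_const
      (p := 1 - γ) (Or.inl (by linarith))).const_mul (γ - 1)⁻¹ |>.neg
    refine HasDerivAt.congr_deriv h ?_
    have e : 1 - γ - 1 = -γ := by ring
    have : γ - 1 ≠ 0 := by linarith
    rw [e, Real.rpow_neg_one]
    field_simp
    ring
  have hp : ∀ x ∈ Set.Ioi t, 0 ≤ x ^ (-1:ℝ) * (1 + Real.log x) ^ (-γ) := fun x hx =>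
    (gpMo_pos' (ht.trans (le_of_lt hx))).le
  have hl : Filter.Tendsto (fun s => -((γ - 1)⁻¹ * (1 + Real.log s) ^ (1 - γ))) Filter.atTop
      (nhds 0) := by
    have h1 : Filter.Tendsto (fun s : ℝ => 1 + Real.log s) Filter.atTop Filter.atTop :=
      Filter.tendsto_atTop_add_const_left _ _ Real.tendsto_log_atTop
    have h2 := (tendsto_rpow_neg_atTop (by linarith : 0 < γ - 1)).comp h1
    have h3 := (h2.const_mul (γ - 1)⁻¹).neg
    simp only [mul_zero, neg_zero, neg_sub] at h3
    exact h3
  have hI := integrableOn_Ioi_deriv_of_nonneg' hg hp hl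
  have hE := integral_Ioi_of_hasDerivAt_of_nonneg' hg hp hl
  unfold gpMo
  rw [← ofReal_integral_eq_lintegral_ofReal hI, hE, ← ENNReal.ofReal_mul]
  · simp
  · have : 0 < γ - 1 := by linarith
    positivity
  · filter_upwards [ae_restrict_mem measurableSet_Ioi] with s hs
    exact hp s hs

lemma gp_div : ∫⁻ t in Set.Ioi (1:ℝ), ENNReal.ofReal ((1 + Real.log t)⁻¹ * t⁻¹) = ⊤ := by
  by_contra hne
  have hI : IntegrableOn (fun t : ℝ => (1 + Real.log t)⁻¹ * t⁻¹) (Set.Ioi 1) := by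
    refine ⟨by fun_prop, ?_⟩
    rw [hasFiniteIntegral_iff_ofReal]
    · exact lt_top_iff_ne_top.2 hne
    · filter_upwards [ae_restrict_mem measurableSet_Ioi] with s hs
      have := gp_L (le_of_lt hs)
      have : (1:ℝ) < s := hs
      simp only [Pi.zero_apply]
      positivity
  have hd : ∀ᶠ x : ℝ in Filter.atTop, HasDerivAt (fun s => Real.log (1 + Real.log s))
      ((1 + Real.log x)⁻¹ * x⁻¹) x := by
    filter_upwards [Filter.eventually_ge_atTop 1] with x hx
    have h1 := gp_L hx
    have h := ((Real.hasDerivAt_log (by linarith : x ≠ 0)).const_add 1).log (by linarith)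
    convert h using 1
    rw [div_eq_mul_inv, mul_comm]
  refine not_integrableOn_of_tendsto_norm_atTop_of_deriv_isBigO_filter Filter.atTop
    (Filter.Ioi_mem_atTop 1) (hd.mono fun x hx => hx.differentiableAt) ?_
    (Filter.EventuallyEq.isBigO (hd.mono fun x hx => hx.deriv)) hI
  exact tendsto_norm_atTop_atTop.comp (Real.tendsto_log_atTop.comp
    (Filter.tendsto_atTop_add_const_left _ _ Real.tendsto_log_atTop))

noncomputable def gpG (B₀ B γ s : ℝ) : ℝ≥0∞ :=
  if s < 1 then ENNReal.ofReal (s ^ (B₀ - 1)) else gpMo (B - 1) (-γ) s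

lemma gpG_split {B₀ B γ t : ℝ} (h0 : 0 < B₀) (ht : 1 ≤ t) :
    ∫⁻ s in Set.Ioo (0:ℝ) t, gpG B₀ B γ s =
      ENNReal.ofReal (1 / B₀) + ∫⁻ s in Set.Ioo (1:ℝ) t, gpMo (B - 1) (-γ) s := by
  rw [← Set.Ioo_union_Ico_eq_Ioo (zero_lt_one) ht, lintegral_union measurableSet_Ico]
  · congr 1
    · rw [setLIntegral_congr_fun (g := fun s => ENNReal.ofReal (s ^ (B₀ - 1))) measurableSet_Ioo,
        gp_int_rpow h0 le_rfl zero_le_one]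
      · simp [Real.zero_rpow h0.ne']
      · intro s hs
        simp [gpG, hs.2]
    · rw [setLIntegral_congr_fun (g := fun s => gpMo (B - 1) (-γ) s) measurableSet_Ico,
        setLIntegral_congr Ioo_ae_eq_Ico]
      intro s hs
      simp [gpG, not_lt.2 hs.1]
  · rw [Set.disjoint_left]
    intro x hx hx'
    exact absurd hx.2 (not_lt.2 hx'.1)

lemma gpG_LB {B₀ B γ : ℝ} (h0 : 0 < B₀) (hB : 0 < B) (hγ : 0 ≤ γ) :
    gpLB (fun t => ∫⁻ s in Set.Ioo (0:ℝ) t, gpG B₀ B γ s) B (-γ) := by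
  set m := min (1 / B₀) (1 / B) with hm
  have m0 : 0 < m := lt_min (by positivity) (by positivity)
  refine ⟨ENNReal.ofReal m, by simpa using m0, by simp, fun t ht => ?_⟩
  have hL := gp_L ht
  have ht0 : 0 < t := by linarith
  set l := (1 + Real.log t) ^ (-γ) with hl
  have l0 : 0 < l := by positivity
  have l1 : l ≤ 1 := Real.rpow_le_one_of_one_le_of_nonpos hL (by linarith)
  have T1 : 1 ≤ t ^ B := Real.one_le_rpow ht hB.le
  simp only
  rw [gpG_split h0 ht]
  have key : ENNReal.ofReal (l * ((t ^ B - 1) / B)) ≤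
      ∫⁻ s in Set.Ioo (1:ℝ) t, gpMo (B - 1) (-γ) s := by
    have e := gp_int_rpow hB zero_le_one ht
    rw [Real.one_rpow] at e
    rw [ENNReal.ofReal_mul l0.le, ← e, ← lintegral_const_mul' _ _ (by simp)]
    refine setLIntegral_mono' measurableSet_Ioo fun s hs => ?_
    have hs0 : 0 < s := by linarith [hs.1]
    have hLs := gp_L hs.1.le
    rw [← ENNReal.ofReal_mul l0.le, mul_comm]
    unfold gpMo
    gcongr ENNReal.ofReal (_ * ?_)
    exact Real.rpow_le_rpow_of_nonpos (by linarith)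
      (by linarith [Real.log_le_log hs0 hs.2.le]) (by linarith)
  refine le_trans ?_ (add_le_add le_rfl key)
  unfold gpMo
  rw [← ENNReal.ofReal_mul m0.le, ← ENNReal.ofReal_add (by positivity)
    (mul_nonneg l0.le (div_nonneg (by linarith) hB.le))]
  apply ENNReal.ofReal_le_ofReal
  have a1 : m ≤ 1 / B₀ := min_le_left _ _
  have a2 : m ≤ 1 / B := min_le_right _ _
  have a3 : m * l ≤ 1 / B₀ := by nlinarith
  have a4 : m * (l * (t ^ B - 1)) ≤ 1 / B * (l * (t ^ B - 1)) :=
    mul_le_mul_of_nonneg_right a2 (mul_nonneg l0.le (by linarith))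
  have a5 : l * ((t ^ B - 1) / B) = 1 / B * (l * (t ^ B - 1)) := by ring
  rw [a5, ← hl]
  nlinarith

lemma gp_slow {B γ : ℝ} (hB : 0 < B) (hγ : 0 ≤ γ) :
    ∃ K : ℝ, 0 < K ∧ ∀ s t : ℝ, 1 ≤ s → s ≤ t →
      s ^ B * (1 + Real.log s) ^ (-γ) ≤ K * (t ^ B * (1 + Real.log t) ^ (-γ)) := by
  set ε := B / (γ + 1) with hε
  have ε0 : 0 < ε := by positivity
  refine ⟨(1 + 1 / ε) ^ γ, by positivity, fun s t hs hst => ?_⟩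
  have hLs := gp_L hs
  have hLt := gp_L (hs.trans hst)
  have hs0 : 0 < s := by linarith
  have ht0 : 0 < t := by linarith
  have hx1 : 1 ≤ t / s := by rw [le_div_iff₀ hs0]; linarith
  set x := t / s with hx
  have htx : t = x * s := by rw [hx]; field_simp
  have h1 : Real.log x ≤ x ^ ε / ε := Real.log_le_rpow_div (by linarith) ε0
  have h2 : 1 ≤ x ^ ε := Real.one_le_rpow hx1 ε0.le
  have hlt : Real.log t = Real.log x + Real.log s := by
    rw [htx, Real.log_mul (by linarith) (by linarith)]
  have h3 : 1 + Real.log t ≤ (1 + Real.log s) * ((1 + 1 / ε) * x ^ ε) := by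
    have h5 : 1 + Real.log x ≤ (1 + 1 / ε) * x ^ ε := by
      have : (1 + 1 / ε) * x ^ ε = x ^ ε + x ^ ε / ε := by ring
      linarith
    have h6 := Real.log_nonneg hs
    have h7 := Real.log_nonneg hx1
    have h8 : 1 + Real.log t ≤ (1 + Real.log s) * (1 + Real.log x) := by
      rw [hlt]; nlinarith
    exact h8.trans (mul_le_mul_of_nonneg_left h5 (by linarith))
  have h4 : (1 + Real.log t) ^ γ ≤ (1 + Real.log s) ^ γ * ((1 + 1 / ε) ^ γ * x ^ B) := by
    refine (Real.rpow_le_rpow (by linarith) h3 hγ).trans ?_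
    rw [Real.mul_rpow (by linarith) (by positivity), Real.mul_rpow (by positivity) (by positivity),
      ← Real.rpow_mul (by linarith)]
    gcongr
    · rw [hε, div_mul_eq_mul_div, div_le_iff₀ (by positivity)]
      nlinarith
  have e : t ^ B = x ^ B * s ^ B := by rw [htx, Real.mul_rpow (by linarith) hs0.le]
  rw [Real.rpow_neg (by linarith), Real.rpow_neg (by linarith), e]
  have p1 : 0 < (1 + Real.log t) ^ γ := by positivity
  have p2 : 0 < (1 + Real.log s) ^ γ := by positivity
  have p3 : 0 < s ^ B := by positivity
  rw [← div_eq_mul_inv, ← div_eq_mul_inv, ← mul_div_assoc, div_le_div_iff₀ p2 p1]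
  calc _ ≤ s ^ B * ((1 + Real.log s) ^ γ * ((1 + 1 / ε) ^ γ * x ^ B)) := by gcongr
    _ = _ := by ring

lemma gpG_UB {B₀ B γ : ℝ} (h0 : 0 < B₀) (hB : 0 < B) (hγ : 0 ≤ γ) :
    gpUB (fun t => ∫⁻ s in Set.Ioo (0:ℝ) t, gpG B₀ B γ s) B (-γ) := by
  obtain ⟨K, K0, hK⟩ := gp_slow (half_pos hB) hγ
  have C0 : 0 < K / B₀ + 2 * K / B := by positivity
  refine ⟨ENNReal.ofReal (K / B₀ + 2 * K / B), by simpa using C0, by simp, fun t ht => ?_⟩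
  have hL := gp_L ht
  have ht0 : 0 < t := by linarith
  set l := (1 + Real.log t) ^ (-γ) with hl
  have l0 : 0 < l := by positivity
  have T1 : 1 ≤ t ^ (B / 2) := Real.one_le_rpow ht (by positivity)
  have TT : t ^ B = t ^ (B / 2) * t ^ (B / 2) := by
    rw [← Real.rpow_add ht0]; congr 1; ring
  set T := t ^ (B / 2) with hT
  simp only
  rw [gpG_split h0 ht]
  have key : ∫⁻ s in Set.Ioo (1:ℝ) t, gpMo (B - 1) (-γ) s ≤
      ENNReal.ofReal (K * (T * l) * ((T - 1) / (B / 2))) := by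
    have e := gp_int_rpow (half_pos hB) zero_le_one ht
    rw [Real.one_rpow] at e
    rw [ENNReal.ofReal_mul (by positivity), ← e, ← lintegral_const_mul' _ _ (by simp)]
    refine setLIntegral_mono' measurableSet_Ioo fun s hs => ?_
    have hs0 : 0 < s := by linarith [hs.1]
    have hLs := gp_L hs.1.le
    rw [← ENNReal.ofReal_mul (by positivity)]
    unfold gpMo
    apply ENNReal.ofReal_le_ofReal
    have e1 : s ^ (B - 1) = s ^ (B / 2) * s ^ (B / 2 - 1) := by
      rw [← Real.rpow_add hs0]; congr 1; ring
    rw [e1, mul_right_comm]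
    have := hK s t hs.1.le hs.2.le
    gcongr
  refine (add_le_add le_rfl key).trans ?_
  have k1 := hK 1 t le_rfl ht
  simp only [Real.one_rpow, Real.log_one, add_zero, mul_one] at k1
  rw [← hl, ← hT] at k1
  unfold gpMo
  rw [← ENNReal.ofReal_mul C0.le, ← ENNReal.ofReal_add (by positivity)
    (mul_nonneg (by positivity) (div_nonneg (by linarith) (by positivity)))]
  apply ENNReal.ofReal_le_ofReal
  rw [← hl, TT]
  have b1 : 1 ≤ K * (T * T * l) := by
    have : T * l ≤ T * T * l := by nlinarith [mul_pos (by linarith : 0 < T) l0]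
    nlinarith
  have b2 : 1 / B₀ ≤ K / B₀ * (T * T * l) := by
    rw [div_mul_eq_mul_div]; gcongr
  have b3 : K * (T * l) * ((T - 1) / (B / 2)) ≤ 2 * K / B * (T * T * l) := by
    have : 2 * K / B * (T * T * l) - K * (T * l) * ((T - 1) / (B / 2)) = 2 * K / B * (T * l) := by
      field_simp; ring
    have : 0 ≤ 2 * K / B * (T * l) := by positivity
    linarith
  linarith

lemma gp_two {a : ℝ} (F : ℝ → ℝ≥0∞) (h : gpUB F a 0) : gpUB (fun t => F (2 * t)) a 0 := by
  obtain ⟨c, c0, c1, hc⟩ := h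
  have : (0:ℝ) < 2 ^ a := by positivity
  refine ⟨c * ENNReal.ofReal (2 ^ a), by simp [c0, this], by simp [c1, ENNReal.mul_eq_top],
    fun t ht => (hc (2 * t) (by linarith)).trans ?_⟩
  rw [mul_assoc]
  unfold gpMo
  rw [← ENNReal.ofReal_mul this.le, Real.mul_rpow (by norm_num) (by linarith)]
  simp

lemma gpW_LB {B δ : ℝ} (hB : 0 ≤ B) (hδ : 0 ≤ δ) :
    gpLB (fun t => ∫⁻ s in Set.Ioo (0:ℝ) (2 * t), if s < 1 then 0 else gpMo (B - 1) (-δ) s)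
      B (-δ) := by
  have c0 : (0:ℝ) < 2⁻¹ * 2 ^ (-δ) := by positivity
  refine ⟨ENNReal.ofReal (2⁻¹ * 2 ^ (-δ)), by simpa using c0, ENNReal.ofReal_ne_top, fun t ht => ?_⟩
  have hL := gp_L ht
  have ht0 : 0 < t := by linarith
  have hsub : Set.Ioo t (2 * t) ⊆ Set.Ioo 0 (2 * t) := Set.Ioo_subset_Ioo ht0.le le_rfl
  refine le_trans ?_ (lintegral_mono_set hsub)
  have e : ENNReal.ofReal (2⁻¹ * 2 ^ (-δ)) * gpMo B (-δ) t =
      ∫⁻ s in Set.Ioo t (2 * t),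
        ENNReal.ofReal (t ^ B / (2 * t) * (2 * (1 + Real.log t)) ^ (-δ)) := by
    rw [setLIntegral_const, Real.volume_Ioo, ← ENNReal.ofReal_mul (by positivity)]
    unfold gpMo
    rw [← ENNReal.ofReal_mul c0.le, Real.mul_rpow (by norm_num) (by linarith)]
    congr 1
    field_simp
    ring
  rw [e]
  refine setLIntegral_mono' measurableSet_Ioo fun s hs => ?_
  have hs1 : 1 ≤ s := ht.trans hs.1.le
  have hLs := gp_L hs1
  have hs0 : 0 < s := by linarith
  rw [if_neg (not_lt.2 hs1)]
  unfold gpMo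
  apply ENNReal.ofReal_le_ofReal
  have hls : 1 + Real.log s ≤ 2 * (1 + Real.log t) := by
    have := Real.log_le_log hs0 hs.2.le
    rw [Real.log_mul (by norm_num) (by linarith)] at this
    have := Real.log_two_lt_d9
    have := Real.log_nonneg ht
    linarith
  rw [Real.rpow_sub_one hs0.ne']
  have := Real.rpow_le_rpow_of_nonpos (by linarith) hls (by linarith : -δ ≤ 0)
  have h1 := hs.1.le
  have h2 := hs.2.le
  gcongr

lemma gpN_LB {F : ℝ → ℝ≥0∞} {γ : ℝ} (hγ : 1 < γ) (h : gpLB F (-1) (-γ)) :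
    gpLB (fun t => ∫⁻ s in Set.Ioi t, F s) 0 (1 - γ) := by
  obtain ⟨c, c0, c1, hc⟩ := h
  have hg : 0 < (γ - 1)⁻¹ := inv_pos.2 (by linarith)
  refine ⟨c * ENNReal.ofReal (γ - 1)⁻¹, mul_ne_zero c0 (by simpa using hγ),
    ENNReal.mul_ne_top c1 (by simp), fun t ht => ?_⟩
  rw [mul_assoc, ← gp_tail hγ ht, ← lintegral_const_mul' _ _ c1]
  exact setLIntegral_mono' measurableSet_Ioi fun s hs => hc s (ht.trans (le_of_lt hs))

lemma gpN_UB {F : ℝ → ℝ≥0∞} {γ : ℝ} (hγ : 1 < γ) (h : gpUB F (-1) (-γ)) :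
    gpUB (fun t => ∫⁻ s in Set.Ioi t, F s) 0 (1 - γ) := by
  obtain ⟨c, c0, c1, hc⟩ := h
  refine ⟨c * ENNReal.ofReal (γ - 1)⁻¹, mul_ne_zero c0 (by simpa using hγ),
    ENNReal.mul_ne_top c1 (by simp), fun t ht => ?_⟩
  rw [mul_assoc, ← gp_tail hγ ht, ← lintegral_const_mul' _ _ c1]
  exact setLIntegral_mono' measurableSet_Ioi fun s hs => hc s (ht.trans (le_of_lt hs))

lemma gp_const {k : ℝ} (hk : 0 < k) : gpLB (fun _ => ENNReal.ofReal k) 0 0 :=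
  ⟨ENNReal.ofReal k, by simpa using hk, by simp, fun t _ => by simp [gpMo]⟩

lemma gp_main (d : ℕ) (hd : 1 ≤ d)
    (α p q r b : ℝ) (hα : 0 < α) (hp : 1 < p) (hpq : p < q)
    (hb : 1/q < b) (hpr : p < r) (hrq : r < q) :
    gpLB (fun t =>
        (UFun d α p t) ^ ((q/p)*(r/p)/((q/p)-(r/p))) *
          (⨆ (y : ℝ) (_ : t ≤ y),
            (UFun d α p y) ^ (-((q/p)*(r/p)/((q/p)-(r/p)))) *
              (WFun d α p q b r y) ^ (((q/p)*(r/p)/((q/p)-(r/p)))/(r/p))) /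
          ((VFun d α p q b t + (UFun d α p t) ^ (q/p) *
              (∫⁻ s in Set.Ioi t, (UFun d α p s) ^ (-(q/p)) * vFun d α p q b s)) ^
            (((q/p)*(r/p)/((q/p)-(r/p)))/(q/p) + 2)) *
          (VFun d α p q b t *
            (∫⁻ s in Set.Ioi t, (UFun d α p s) ^ (-(q/p)) * vFun d α p q b s)) *
          (ENNReal.ofReal (q/p) * (UFun d α p t) ^ (q/p - 1) * uFun d α p t)) (-1) (-1) := by
  have hd' : (1:ℝ) ≤ d := by exact_mod_cast hd
  have hp0 : 0 < p := by linarith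
  have hq0 : 0 < q := by linarith
  have hr0 : 0 < r := by linarith
  have hγ : 1 < b * q := by rwa [div_lt_iff₀ hq0] at hb
  have hδ : 0 ≤ (b - 1 / q) * r := mul_nonneg (by linarith) hr0.le
  have hQ0 : 0 < q / p := by positivity
  have hQ1 : 0 ≤ q / p - 1 := by
    have : 1 ≤ q / p := by rw [le_div_iff₀ hp0]; linarith
    linarith
  have hR0 : 0 < r / p := by positivity
  have hQR : 0 < q / p - r / p := by
    rw [← sub_div]; exact div_pos (by linarith) hp0
  have hP0 : 0 < (q/p)*(r/p)/((q/p)-(r/p)) := by positivity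
  set P := (q/p)*(r/p)/((q/p)-(r/p)) with hP
  clear_value P
  set A := α*p + (d:ℝ)*p - d with hA
  have hA₀ : 0 < (d:ℝ)*p - d := by nlinarith
  have hA0 : 0 < A := by nlinarith [mul_pos hα hp0]
  have hB : α*q + (d:ℝ)*q - (d:ℝ)*q/p = A * (q/p) := by rw [hA]; field_simp
  have hC : α*r + (d:ℝ)*r - (d:ℝ)*r/p = A * (r/p) := by rw [hA]; field_simp
  have hB₀ : (d:ℝ)*q - (d:ℝ)*q/p = ((d:ℝ)*p - d) * (q/p) := by field_simp
  have hB₀0 : 0 < (d:ℝ)*q - (d:ℝ)*q/p := by rw [hB₀]; positivity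
  have hu : ∀ s, uFun d α p s = gpG ((d:ℝ)*p - d) A 0 s := by
    intro s; simp [uFun, gpG, gpMo, hA]
  have hv : ∀ s, vFun d α p q b s = gpG ((d:ℝ)*q - (d:ℝ)*q/p) (A * (q/p)) (b*q) s := by
    intro s; simp only [vFun, gpG, gpMo, hB]
  have hw : ∀ s, wFun d α p q b r s =
      if s < 1 then 0 else gpMo (A * (r/p) - 1) (-((b - 1/q) * r)) s := by
    intro s; simp only [wFun, gpMo, hC]
    congr 4; ring
  have hB0 : 0 < A * (q/p) := by positivity
  have Ul : gpLB (UFun d α p) A 0 := by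
    have := gpG_LB hA₀ hA0 (le_refl 0)
    simp only [← hu, neg_zero] at this; exact this
  have Uu : gpUB (UFun d α p) A 0 := by
    have := gpG_UB hA₀ hA0 (le_refl 0)
    simp only [← hu, neg_zero] at this; exact this
  have Vl : gpLB (VFun d α p q b) (A * (q/p)) (-(b*q)) := by
    have := gpG_LB hB₀0 hB0 (by linarith : 0 ≤ b * q)
    simp only [← hv] at this; exact this
  have Vu : gpUB (VFun d α p q b) (A * (q/p)) (-(b*q)) := by
    have := gpG_UB hB₀0 hB0 (by linarith : 0 ≤ b * q)
    simp only [← hv] at this; exact this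
  have Wl : gpLB (fun t => WFun d α p q b r (2 * t)) (A * (r/p)) (-((b - 1/q) * r)) := by
    have := gpW_LB (by positivity : 0 ≤ A * (r/p)) hδ
    simp only [← hw] at this; exact this
  have U2 := gp_two _ Uu
  have ul : gpLB (uFun d α p) (A - 1) 0 := by
    refine ⟨1, by simp, by simp, fun t ht => ?_⟩
    rw [hu, gpG, if_neg (not_lt.2 ht)]; simp
  have vl : gpLB (vFun d α p q b) (A * (q/p) - 1) (-(b*q)) := by
    refine ⟨1, by simp, by simp, fun t ht => ?_⟩
    rw [hv, gpG, if_neg (not_lt.2 ht)]; simp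
  have vu : gpUB (vFun d α p q b) (A * (q/p) - 1) (-(b*q)) := by
    refine ⟨1, by simp, by simp, fun t ht => ?_⟩
    rw [hv, gpG, if_neg (not_lt.2 ht)]; simp
  have Nl : gpLB (fun t => ∫⁻ s in Set.Ioi t, (UFun d α p s) ^ (-(q/p)) * vFun d α p q b s)
      0 (1 - b * q) := by
    apply gpN_LB hγ
    convert (Uu.rpow_neg hQ0.le).mul vl using 1 <;> ring
  have Nu : gpUB (fun t => ∫⁻ s in Set.Ioi t, (UFun d α p s) ^ (-(q/p)) * vFun d α p q b s)
      0 (1 - b * q) := by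
    apply gpN_UB hγ
    convert (Ul.rpow_neg hQ0.le).mul vu using 1 <;> ring
  have Sl : gpLB (fun t => ⨆ (y : ℝ) (_ : t ≤ y),
            (UFun d α p y) ^ (-P) * (WFun d α p q b r y) ^ (P/(r/p)))
      (-(A * P) + A * (r/p) * (P/(r/p))) (-(0 * P) + -((b - 1/q) * r) * (P/(r/p))) := by
    obtain ⟨c, c0, c1, hc⟩ := (U2.rpow_neg hP0.le).mul (Wl.rpow (by positivity : 0 ≤ P/(r/p)))
    refine ⟨c, c0, c1, fun t ht => (hc t ht).trans ?_⟩
    exact le_iSup₂ (f := fun (y : ℝ) (_ : t ≤ y) =>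
      (UFun d α p y) ^ (-P) * (WFun d α p q b r y) ^ (P/(r/p))) (2 * t) (by linarith)
  have Du : gpUB (fun t => VFun d α p q b t + (UFun d α p t) ^ (q/p) *
              (∫⁻ s in Set.Ioi t, (UFun d α p s) ^ (-(q/p)) * vFun d α p q b s))
      (A * (q/p)) (1 - b * q) := by
    refine (Vu.mono (by linarith)).add ?_
    convert (Uu.rpow hQ0.le).mul Nu using 1 <;> ring
  have Dl := (Du.rpow (by positivity : 0 ≤ P/(q/p) + 2)).inv
  have F := ((((Ul.rpow hP0.le).mul Sl).mul Dl).mul (Vl.mul Nl)).mul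
    (((gp_const hQ0).mul (Ul.rpow hQ1)).mul ul)
  simp only [div_eq_mul_inv] at F ⊢
  convert F using 1
  · field_simp
    ring
  · field_simp
    ring

/-- divergence of the Gogatishvili–Pick integral condition for the
limiting Sobolev embedding.  With `R = r/p`, `Q = q/p`, `P = QR/(Q−R)`, the integral
`∫₁^∞ [U^P sup_{y≥t} U(y)^{−P}W(y)^{P/R}] / [V + U^Q∫_t^∞ U^{−Q}v]^{P/Q+2}
   · V(t)∫_t^∞ U^{−Q}v · d(U^Q(t))`
(the Stieltjes differential `d(U^Q(t))` being `Q U(t)^{Q−1}u(t) dt`) is comparable to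
`∫₁^∞ dt/((1+log t)t)` and hence diverges. -/
theorem gogatishvili_pick_condition_diverges (d : ℕ) (hd : 1 ≤ d)
    (α p q r b : ℝ) (hα : 0 < α) (hp : 1 < p) (hpq : p < q)
    (hb : 1/q < b) (hpr : p < r) (hrq : r < q) :
    (∃ c C : ℝ≥0∞, c ≠ 0 ∧ C ≠ ⊤ ∧
      c * (∫⁻ t in Set.Ioi (1:ℝ), ENNReal.ofReal ((1 + Real.log t)⁻¹ * t⁻¹))
        ≤ (∫⁻ t in Set.Ioi (1:ℝ),
            (UFun d α p t) ^ ((q/p)*(r/p)/((q/p)-(r/p))) *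
              (⨆ (y : ℝ) (_ : t ≤ y),
                (UFun d α p y) ^ (-((q/p)*(r/p)/((q/p)-(r/p)))) *
                  (WFun d α p q b r y) ^ (((q/p)*(r/p)/((q/p)-(r/p)))/(r/p))) /
              ((VFun d α p q b t + (UFun d α p t) ^ (q/p) *
                  (∫⁻ s in Set.Ioi t, (UFun d α p s) ^ (-(q/p)) * vFun d α p q b s)) ^
                (((q/p)*(r/p)/((q/p)-(r/p)))/(q/p) + 2)) *
              (VFun d α p q b t *
                (∫⁻ s in Set.Ioi t, (UFun d α p s) ^ (-(q/p)) * vFun d α p q b s)) *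
              (ENNReal.ofReal (q/p) * (UFun d α p t) ^ (q/p - 1) * uFun d α p t)) ∧
      (∫⁻ t in Set.Ioi (1:ℝ),
            (UFun d α p t) ^ ((q/p)*(r/p)/((q/p)-(r/p))) *
              (⨆ (y : ℝ) (_ : t ≤ y),
                (UFun d α p y) ^ (-((q/p)*(r/p)/((q/p)-(r/p)))) *
                  (WFun d α p q b r y) ^ (((q/p)*(r/p)/((q/p)-(r/p)))/(r/p))) /
              ((VFun d α p q b t + (UFun d α p t) ^ (q/p) *
                  (∫⁻ s in Set.Ioi t, (UFun d α p s) ^ (-(q/p)) * vFun d α p q b s)) ^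
                (((q/p)*(r/p)/((q/p)-(r/p)))/(q/p) + 2)) *
              (VFun d α p q b t *
                (∫⁻ s in Set.Ioi t, (UFun d α p s) ^ (-(q/p)) * vFun d α p q b s)) *
              (ENNReal.ofReal (q/p) * (UFun d α p t) ^ (q/p - 1) * uFun d α p t))
        ≤ C * (∫⁻ t in Set.Ioi (1:ℝ), ENNReal.ofReal ((1 + Real.log t)⁻¹ * t⁻¹))) ∧
    (∫⁻ t in Set.Ioi (1:ℝ),
        (UFun d α p t) ^ ((q/p)*(r/p)/((q/p)-(r/p))) *
          (⨆ (y : ℝ) (_ : t ≤ y),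
            (UFun d α p y) ^ (-((q/p)*(r/p)/((q/p)-(r/p)))) *
              (WFun d α p q b r y) ^ (((q/p)*(r/p)/((q/p)-(r/p)))/(r/p))) /
          ((VFun d α p q b t + (UFun d α p t) ^ (q/p) *
              (∫⁻ s in Set.Ioi t, (UFun d α p s) ^ (-(q/p)) * vFun d α p q b s)) ^
            (((q/p)*(r/p)/((q/p)-(r/p)))/(q/p) + 2)) *
          (VFun d α p q b t *
            (∫⁻ s in Set.Ioi t, (UFun d α p s) ^ (-(q/p)) * vFun d α p q b s)) *
          (ENNReal.ofReal (q/p) * (UFun d α p t) ^ (q/p - 1) * uFun d α p t)) = ⊤ := by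
  have F := gp_main d hd α p q r b hα hp hpq hb hpr hrq
  have key := F
  obtain ⟨c, c0, c1, hc⟩ := key
  have htop : ∫⁻ t in Set.Ioi (1:ℝ), c * gpMo (-1) (-1) t = ⊤ := by
    rw [lintegral_const_mul' _ _ c1]
    have : ∫⁻ t in Set.Ioi (1:ℝ), gpMo (-1) (-1) t = ⊤ := by
      rw [← gp_div]
      refine setLIntegral_congr_fun measurableSet_Ioi fun t ht => ?_
      simp only [gpMo, Real.rpow_neg_one]
      rw [mul_comm]
    rw [this, ENNReal.mul_top c0]
  have hI := top_unique (htop.symm.le.trans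
    (setLIntegral_mono' measurableSet_Ioi fun t ht => hc t (le_of_lt ht)))
  refine ⟨⟨1, 1, one_ne_zero, ENNReal.one_ne_top, ?_, ?_⟩, hI⟩
  · rw [hI]; exact le_top
  · rw [gp_div, one_mul]; exact le_top
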